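/- Let C ≥ 1 and let p ∈ ℝ^C satisfy p_j > 0 for all j and Σ_{j=1}^C p_j = 1. Define g : ℝ^C → ℝ by g(y) = (1/2) · Σ_{k=1}^C p_k · log(p_k / m_k) + (1/2) · Σ_{k=1}^C s_k · log(s_k / m_k), where s = softmax(y) and m_k = (p_k + s_k)/2. Then for every y ∈ ℝ^C and every index i, ∂g/∂y_i = (1/2) · s_i · ( log(s_i / m_i) − Σ_{j=1}^C s_j · log(s_j / m_j) ). -/

import Mathlib

open Real

/-- softmax of logits `o : Fin C → ℝ`. -/
noncomputable def softmax {C : ℕ} (o : Fin C → ℝ) (j : Fin C) : ℝ :=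
  Real.exp (o j) / ∑ k, Real.exp (o k)

theorem softmax_pos_aux {C : ℕ} (y : Fin C → ℝ) (k : Fin C) : 0 < softmax y k := by
  unfold softmax
  exact div_pos (Real.exp_pos _)
    (Finset.sum_pos (fun j _ => Real.exp_pos _) ⟨k, Finset.mem_univ k⟩)

theorem softmax_hasDerivAt_aux {C : ℕ} (y : Fin C → ℝ) (i k : Fin C) :
    HasDerivAt (fun t => softmax (Function.update y i t) k)
      (softmax y k * ((if k = i then 1 else 0) - softmax y i)) (y i) := by
  have hZ : 0 < ∑ j, Real.exp (y j) :=
    Finset.sum_pos (fun j _ => Real.exp_pos _) ⟨k, Finset.mem_univ k⟩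
  have he : ∀ j : Fin C, HasDerivAt (fun t => Real.exp (Function.update y i t j))
      (if j = i then Real.exp (y j) else 0) (y i) := by
    intro j
    by_cases h : j = i
    · subst h
      simpa using Real.hasDerivAt_exp (y j)
    · simpa [h] using hasDerivAt_const (y i) (Real.exp (y j))
  have hs : HasDerivAt (fun t => ∑ j, Real.exp (Function.update y i t j))
      (Real.exp (y i)) (y i) := by
    have := HasDerivAt.fun_sum (u := Finset.univ) (fun j _ => he j)
    simpa using this
  have hd := (he k).fun_div hs (by simpa using hZ.ne')
  unfold softmax
  refine hd.congr_deriv ?_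
  simp only [Function.update_eq_self]
  have hZ' := hZ.ne'
  split_ifs with h
  · subst h
    field_simp
  · field_simp
    ring

theorem jsd_term_aux {f : ℝ → ℝ} {f' x q : ℝ} (hq : 0 < q) (hx : 0 < f x)
    (hf : HasDerivAt f f' x) :
    HasDerivAt (fun t => q * Real.log (q / ((q + f t) / 2))
      + f t * Real.log (f t / ((q + f t) / 2)))
      (f' * Real.log (f x / ((q + f x) / 2))) x := by
  have hm : HasDerivAt (fun t => (q + f t) / 2) (f' / 2) x := (hf.const_add q).div_const 2
  have hmp : 0 < (q + f x) / 2 := by positivity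
  have h1 := (((hasDerivAt_const x q).fun_div hm hmp.ne').log
    (div_pos hq hmp).ne').const_mul q
  have h2 := hf.fun_mul ((hf.fun_div hm hmp.ne').log (div_pos hx hmp).ne')
  refine (h1.fun_add h2).congr_deriv ?_
  have hne : q + f x ≠ 0 := by positivity
  generalize Real.log (f x / ((q + f x) / 2)) = L
  field_simp
  ring

/-- Gradient of the Jensen–Shannon divergence `JSD(p ‖ softmax y)` with respect to the
student logits `y`: with `s = softmax y` and `m_k = (p_k + s_k)/2`,
`∂g/∂y_i = (1/2) s_i (log (s_i / m_i) - ∑ j, s_j log (s_j / m_j))`. -/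
theorem jsd_logits_partial_deriv (C : ℕ) (hC : 1 ≤ C) (p : Fin C → ℝ)
    (hp : ∀ j, 0 < p j) (hp1 : ∑ j, p j = 1) (y : Fin C → ℝ) (i : Fin C) :
    HasDerivAt
      (fun t =>
        (1 / 2 : ℝ) * ∑ k, p k *
            Real.log (p k / ((p k + softmax (Function.update y i t) k) / 2))
        + (1 / 2 : ℝ) * ∑ k, softmax (Function.update y i t) k *
            Real.log (softmax (Function.update y i t) k
              / ((p k + softmax (Function.update y i t) k) / 2)))
      ((1 / 2 : ℝ) * softmax y i *
        (Real.log (softmax y i / ((p i + softmax y i) / 2))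
          - ∑ j, softmax y j * Real.log (softmax y j / ((p j + softmax y j) / 2)))) (y i) := by
  have h := HasDerivAt.fun_sum (u := Finset.univ) (fun k _ =>
    jsd_term_aux (hp k) (by simpa using softmax_pos_aux y k) (softmax_hasDerivAt_aux y i k))
  have h' := h.const_mul (1 / 2 : ℝ)
  simp only [Finset.sum_add_distrib, mul_add] at h'
  refine h'.congr_deriv ?_
  simp only [Function.update_eq_self]
  rw [mul_assoc]
  congr 1
  have : ∀ k, softmax y k * ((if k = i then 1 else 0) - softmax y i)
      * Real.log (softmax y k / ((p k + softmax y k) / 2))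
      = (if k = i then softmax y k * Real.log (softmax y k / ((p k + softmax y k) / 2)) else 0)
        - softmax y i * (softmax y k * Real.log (softmax y k / ((p k + softmax y k) / 2))) := by
    intro k
    split_ifs <;> ring
  simp only [this, Finset.sum_sub_distrib, ← Finset.mul_sum, Finset.sum_ite_eq',
    Finset.mem_univ, if_true]
  ring
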